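/- For every i with 1 ≤ i ≤ N−1 there exist F-linear operators G_J on F[z_1,…,z_N], indexed by the subsets J ⊆ {1,…,N} with |J| = i+1, such that for every symmetric polynomial f ∈ F[z_1,…,z_N]: [H, B⁺_i] f = B⁺_i ( 2 Σ_{j=1}^N D_j + i + β i(N−i) ) f + Σ_{J⊆{1,…,N}, |J|=i+1} G_J Ñ_{i+1,J} f. -/

import Mathlib

open MvPolynomial Finset

section CSDefs

variable {F : Type*} [Field F] [CharZero F]

/-- Exact division in a polynomial ring: `divExact d f = f / d` when `d ∣ f`, junk otherwise. -/
noncomputable def divExact {σ : Type*} (d f : MvPolynomial σ F) : MvPolynomial σ F := by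
  classical exact if h : ∃ c, f = d * c then h.choose else 0

/-- The exchange operator `K_{ij}` permuting the variables `z_i` and `z_j`. -/
noncomputable def Kswap {N : ℕ} (i j : Fin N) (f : MvPolynomial (Fin N) F) :
    MvPolynomial (Fin N) F :=
  rename (Equiv.swap i j) f

/-- The Dunkl operator `∇_i = ∂_i + β ∑_{j ≠ i} (z_i - z_j)⁻¹ (1 - K_{ij})`. -/
noncomputable def nabla {N : ℕ} (β : F) (i : Fin N) (f : MvPolynomial (Fin N) F) :
    MvPolynomial (Fin N) F :=
  pderiv i f + β • ∑ j ∈ Finset.univ.erase i, divExact (X i - X j) (f - Kswap i j f)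

/-- `D_i = z_i ∇_i`. -/
noncomputable def Dop {N : ℕ} (β : F) (i : Fin N) (f : MvPolynomial (Fin N) F) :
    MvPolynomial (Fin N) F :=
  X i * nabla β i f

/-- `(D_{j₁} + kβ)(D_{j₂} + (k+1)β) ⋯` applied along a list of indices. -/
noncomputable def Dlist {N : ℕ} (β : F) :
    ℕ → List (Fin N) → MvPolynomial (Fin N) F → MvPolynomial (Fin N) F
  | _, [], f => f
  | k, j :: rest, f => Dop β j (Dlist β (k + 1) rest f) + ((k : F) * β) • Dlist β (k + 1) rest f

/-- `D_{k,J} = (D_{j₁} + kβ)(D_{j₂} + (k+1)β) ⋯ (D_{j_ℓ} + (k+ℓ-1)β)` for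
`J = {j₁ < j₂ < … < j_ℓ}`. -/
noncomputable def DJ {N : ℕ} (β : F) (k : ℕ) (J : Finset (Fin N))
    (f : MvPolynomial (Fin N) F) : MvPolynomial (Fin N) F :=
  Dlist β k (J.sort (· ≤ ·)) f

/-- `z_J = ∏_{i ∈ J} z_i`. -/
noncomputable def zJ {N : ℕ} (J : Finset (Fin N)) : MvPolynomial (Fin N) F := ∏ i ∈ J, X i

/-- The creation operator `B⁺_{i,J} = ∑_{J' ⊆ J, |J'| = i} z_{J'} D_{1,J'}`. -/
noncomputable def Bplus {N : ℕ} (β : F) (i : ℕ) (J : Finset (Fin N))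
    (f : MvPolynomial (Fin N) F) : MvPolynomial (Fin N) F :=
  ∑ J' ∈ J.powersetCard i, zJ J' * DJ β 1 J' f

/-- `A_{ij} = ((z_i+z_j)/(z_i-z_j))(z_i ∂_i - z_j ∂_j)`. -/
noncomputable def Aop {N : ℕ} (i j : Fin N) (f : MvPolynomial (Fin N) F) :
    MvPolynomial (Fin N) F :=
  divExact (X i - X j) ((X i + X j) * (X i * pderiv i f - X j * pderiv j f))

/-- `H^{(S)} = ∑_{i ∈ S} (z_i ∂_i)² + β ∑_{i<j, i,j ∈ S} A_{ij}`. -/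
noncomputable def Hop {N : ℕ} (β : F) (S : Finset (Fin N)) (f : MvPolynomial (Fin N) F) :
    MvPolynomial (Fin N) F :=
  ∑ i ∈ S, X i * pderiv i (X i * pderiv i f)
    + β • ∑ i ∈ S, ∑ j ∈ S.filter (fun j => i < j), Aop i j f

/-- A polynomial is symmetric in the variables indexed by `S`. -/
def SymmOn {N : ℕ} (S : Finset (Fin N)) (f : MvPolynomial (Fin N) F) : Prop :=
  ∀ i ∈ S, ∀ j ∈ S, rename (Equiv.swap i j) f = f

/-- `phiCS β N lam i = (B⁺_i)^{λ_i - λ_{i+1}} ⋯ (B⁺_1)^{λ_1 - λ_2} · 1`,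
where `lam` is 0-indexed: `lam (j-1) = λ_j`. -/
noncomputable def phiCS (β : F) (N : ℕ) (lam : ℕ → ℕ) : ℕ → MvPolynomial (Fin N) F
  | 0 => 1
  | i + 1 => (fun f => Bplus β (i + 1) Finset.univ f)^[lam i - lam (i + 1)] (phiCS β N lam i)

/-- The monomial symmetric polynomial attached to an exponent vector. -/
noncomputable def msym (N : ℕ) (lam : Fin N → ℕ) : MvPolynomial (Fin N) F := by
  classical
  exact ∑ v ∈ (Finset.univ : Finset (Equiv.Perm (Fin N))).image
      (fun σ => fun i => lam (σ i)), ∏ i, X i ^ v i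

/-- `𝐷̂_i = D_i + β(i-1) - β ∑_{j<i} (1 - K_{ij})` (0-indexed: `i-1` becomes `i`). -/
noncomputable def Dhat {N : ℕ} (β : F) (i : Fin N) (f : MvPolynomial (Fin N) F) :
    MvPolynomial (Fin N) F :=
  Dop β i f + (β * ((i : ℕ) : F)) • f
    - β • ∑ j ∈ Finset.univ.filter (fun j => j < i), (f - Kswap i j f)

end CSDefs

section DunklAlgebra

variable {F : Type*} [Field F] {N : ℕ}

theorem divExact_eq {σ : Type*} {d f c : MvPolynomial σ F} (hd : d ≠ 0) (h : d * c = f) :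
    divExact d f = c := by
  have hex : ∃ c, f = d * c := ⟨c, h.symm⟩
  rw [divExact, dif_pos hex]
  exact mul_left_cancel₀ hd (hex.choose_spec.symm.trans h.symm)

theorem X_sub_X_ne_zero {i j : Fin N} (h : i ≠ j) :
    (X i - X j : MvPolynomial (Fin N) F) ≠ 0 :=
  sub_ne_zero.2 fun e => h (X_injective e)

theorem X_sub_X_dvd_sub_Kswap (i j : Fin N) (f : MvPolynomial (Fin N) F) :
    (X i - X j : MvPolynomial (Fin N) F) ∣ f - Kswap i j f := by
  induction f using MvPolynomial.induction_on with
  | C a => simp [Kswap]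
  | add p q hp hq =>
    have : p + q - Kswap i j (p + q) = (p - Kswap i j p) + (q - Kswap i j q) := by
      simp only [Kswap, map_add]; ring
    exact this ▸ dvd_add hp hq
  | mul_X p k hp =>
    have h : (X i - X j : MvPolynomial (Fin N) F) ∣ X k - Kswap i j (X k) := by
      simp only [Kswap, rename_X]
      rcases eq_or_ne k i with rfl | hi
      · simp
      rcases eq_or_ne k j with rfl | hj
      · rw [Equiv.swap_apply_right, ← neg_sub, neg_dvd]
      · simp [Equiv.swap_apply_of_ne_of_ne hi hj]
    have : p * X k - Kswap i j (p * X k)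
        = (p - Kswap i j p) * X k + Kswap i j p * (X k - Kswap i j (X k)) := by
      simp only [Kswap, map_mul]; ring
    exact this ▸ dvd_add (hp.mul_right _) (h.mul_left _)

/-- The divided difference `(z_i - z_j)⁻¹ (1 - K_{ij})`. -/
noncomputable def divDiff (i j : Fin N) (f : MvPolynomial (Fin N) F) : MvPolynomial (Fin N) F :=
  divExact (X i - X j) (f - Kswap i j f)

theorem mul_divDiff {i j : Fin N} (h : i ≠ j) (f : MvPolynomial (Fin N) F) :
    (X i - X j) * divDiff i j f = f - Kswap i j f := by
  obtain ⟨c, hc⟩ := X_sub_X_dvd_sub_Kswap i j f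
  rw [divDiff, divExact_eq (X_sub_X_ne_zero h) hc.symm, hc]

theorem divDiff_eq {i j : Fin N} (h : i ≠ j) {f c : MvPolynomial (Fin N) F}
    (hc : (X i - X j) * c = f - Kswap i j f) : divDiff i j f = c :=
  divExact_eq (X_sub_X_ne_zero h) hc

theorem divDiff_add {i j : Fin N} (h : i ≠ j) (f g : MvPolynomial (Fin N) F) :
    divDiff i j (f + g) = divDiff i j f + divDiff i j g := by
  refine divDiff_eq h ?_
  rw [mul_add, mul_divDiff h, mul_divDiff h]
  simp only [Kswap, map_add]; ring

theorem divDiff_mul {i j : Fin N} (h : i ≠ j) (f g : MvPolynomial (Fin N) F) :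
    divDiff i j (f * g) = f * divDiff i j g + divDiff i j f * Kswap i j g := by
  refine divDiff_eq h ?_
  have h1 := mul_divDiff h f
  have h2 := mul_divDiff h g
  simp only [Kswap, map_mul] at *
  linear_combination f * h2 + rename (Equiv.swap i j) g * h1

theorem divDiff_of_Kswap_eq {i j : Fin N} (h : i ≠ j) {f : MvPolynomial (Fin N) F}
    (hf : Kswap i j f = f) : divDiff i j f = 0 :=
  divDiff_eq h (by rw [hf, mul_zero, sub_self])

theorem divDiff_smul {i j : Fin N} (h : i ≠ j) (a : F) (f : MvPolynomial (Fin N) F) :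
    divDiff i j (a • f) = a • divDiff i j f := by
  rw [smul_eq_C_mul, smul_eq_C_mul, divDiff_mul h,
    divDiff_of_Kswap_eq h (f := C a) (by simp [Kswap]), zero_mul, add_zero]

theorem rename_Kswap (σ : Equiv.Perm (Fin N)) (i j : Fin N) (f : MvPolynomial (Fin N) F) :
    rename σ (Kswap i j f) = Kswap (σ i) (σ j) (rename σ f) := by
  rw [Kswap, Kswap, rename_rename, rename_rename]
  congr 2
  funext x
  have := Equiv.swap_apply_apply σ i j
  simp [this]

theorem rename_divDiff (σ : Equiv.Perm (Fin N)) {i j : Fin N} (h : i ≠ j)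
    (f : MvPolynomial (Fin N) F) :
    rename σ (divDiff i j f) = divDiff (σ i) (σ j) (rename σ f) := by
  refine (divDiff_eq (σ.injective.ne h) ?_).symm
  rw [← rename_Kswap, ← map_sub, ← mul_divDiff h, map_mul, map_sub, rename_X, rename_X]

theorem Kswap_Kswap (i j : Fin N) (f : MvPolynomial (Fin N) F) :
    Kswap i j (Kswap i j f) = f := by
  rw [Kswap, Kswap, rename_rename, ← Equiv.Perm.coe_mul, Equiv.swap_mul_self]
  simp

theorem nabla_eq (β : F) (i : Fin N) (f : MvPolynomial (Fin N) F) :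
    nabla β i f = pderiv i f + β • ∑ j ∈ univ.erase i, divDiff i j f := rfl

theorem rename_nabla (β : F) (σ : Equiv.Perm (Fin N)) (i : Fin N) (f : MvPolynomial (Fin N) F) :
    rename σ (nabla β i f) = nabla β (σ i) (rename σ f) := by
  simp only [nabla_eq, map_add, map_smul, map_sum, pderiv_rename σ.injective]
  congr 2
  refine Finset.sum_bij' (fun j _ => σ j) (fun j _ => σ.symm j) ?_ ?_ ?_ ?_ ?_
  · simp
  · simp [Equiv.symm_apply_eq]
  · simp
  · simp
  · intro j hj
    exact rename_divDiff σ (Finset.ne_of_mem_erase hj).symm f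

theorem nabla_mul (β : F) (i : Fin N) (p f : MvPolynomial (Fin N) F) :
    nabla β i (p * f) = p * nabla β i f + pderiv i p * f
      + β • ∑ j ∈ univ.erase i, divDiff i j p * Kswap i j f := by
  have : ∑ j ∈ univ.erase i, divDiff i j (p * f)
      = p * ∑ j ∈ univ.erase i, divDiff i j f
        + ∑ j ∈ univ.erase i, divDiff i j p * Kswap i j f := by
    rw [Finset.mul_sum, ← Finset.sum_add_distrib]
    exact Finset.sum_congr rfl fun j hj => divDiff_mul (Finset.ne_of_mem_erase hj).symm p f
  rw [nabla_eq, this, Derivation.leibniz, nabla_eq]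
  simp only [smul_eq_mul, smul_eq_C_mul]
  ring

theorem nabla_add (β : F) (i : Fin N) (f g : MvPolynomial (Fin N) F) :
    nabla β i (f + g) = nabla β i f + nabla β i g := by
  have : ∑ j ∈ univ.erase i, divDiff i j (f + g)
      = ∑ j ∈ univ.erase i, divDiff i j f + ∑ j ∈ univ.erase i, divDiff i j g := by
    rw [← Finset.sum_add_distrib]
    exact Finset.sum_congr rfl fun j hj => divDiff_add (Finset.ne_of_mem_erase hj).symm f g
  rw [nabla_eq, this, nabla_eq, nabla_eq, map_add, smul_add]
  abel

theorem nabla_smul (β : F) (i : Fin N) (a : F) (f : MvPolynomial (Fin N) F) :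
    nabla β i (a • f) = a • nabla β i f := by
  have : ∑ j ∈ univ.erase i, divDiff i j (a • f) = a • ∑ j ∈ univ.erase i, divDiff i j f := by
    rw [Finset.smul_sum]
    exact Finset.sum_congr rfl fun j hj => divDiff_smul (Finset.ne_of_mem_erase hj).symm a f
  rw [nabla_eq, this, nabla_eq, Derivation.map_smul, smul_add, smul_comm]

/-- The Dunkl operator `∇_i` as a linear map. -/
noncomputable def nablaLin (β : F) (i : Fin N) : Module.End F (MvPolynomial (Fin N) F) where
  toFun := nabla β i
  map_add' := nabla_add β i
  map_smul' := nabla_smul β i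

/-- `D_i` as a linear map. -/
noncomputable def dunkl (β : F) (i : Fin N) : Module.End F (MvPolynomial (Fin N) F) where
  toFun := Dop β i
  map_add' f g := by rw [Dop, nabla_add, mul_add]; rfl
  map_smul' a f := by rw [Dop, nabla_smul, mul_smul_comm]; rfl

/-- The action of a permutation of the variables as a linear map. -/
noncomputable def permute (σ : Equiv.Perm (Fin N)) : Module.End F (MvPolynomial (Fin N) F) :=
  (rename σ).toLinearMap

/-- The exchange operator `K_{ij}` as a linear map. -/
noncomputable abbrev exch (i j : Fin N) : Module.End F (MvPolynomial (Fin N) F) :=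
  permute (Equiv.swap i j)

theorem permute_nablaLin (β : F) (σ : Equiv.Perm (Fin N)) (i : Fin N)
    (f : MvPolynomial (Fin N) F) :
    permute σ (nablaLin β i f) = nablaLin β (σ i) (permute σ f) :=
  rename_nabla β σ i f

theorem permute_dunkl (β : F) (σ : Equiv.Perm (Fin N)) (i : Fin N)
    (f : MvPolynomial (Fin N) F) :
    permute σ (dunkl β i f) = dunkl β (σ i) (permute σ f) := by
  change rename σ (X i * nabla β i f) = X (σ i) * nabla β (σ i) (rename σ f)
  rw [map_mul, rename_X, rename_nabla]

theorem divDiff_X_self {i j : Fin N} (h : i ≠ j) :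
    divDiff i j (X i : MvPolynomial (Fin N) F) = 1 :=
  divDiff_eq h (by simp [Kswap])

theorem divDiff_X_right {i j : Fin N} (h : i ≠ j) :
    divDiff i j (X j : MvPolynomial (Fin N) F) = -1 :=
  divDiff_eq h (by simp [Kswap])

theorem nablaLin_X_mul_self (β : F) (i : Fin N) (f : MvPolynomial (Fin N) F) :
    nablaLin β i (X i * f) = X i * nablaLin β i f + f + β • ∑ j ∈ univ.erase i, exch i j f := by
  refine (nabla_mul β i (X i) f).trans ?_
  rw [pderiv_X_self, one_mul]
  congr 2
  refine Finset.sum_congr rfl fun j hj => ?_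
  rw [divDiff_X_self (Finset.ne_of_mem_erase hj).symm, one_mul]
  rfl

theorem nablaLin_X_mul_of_ne (β : F) {i k : Fin N} (h : i ≠ k) (f : MvPolynomial (Fin N) F) :
    nablaLin β i (X k * f) = X k * nablaLin β i f - β • exch i k f := by
  refine (nabla_mul β i (X k) f).trans ?_
  rw [pderiv_X_of_ne h.symm, zero_mul, add_zero, Finset.sum_eq_single_of_mem k (by simp [h.symm]),
    divDiff_X_right h, neg_one_mul, smul_neg, ← sub_eq_add_neg]
  · rfl
  · intro j hj hjk
    rw [divDiff_of_Kswap_eq (Finset.ne_of_mem_erase hj).symm, zero_mul]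
    simp [Kswap, Equiv.swap_apply_of_ne_of_ne h.symm hjk.symm]

theorem exch_nablaLin_left (β : F) (i j : Fin N) (f : MvPolynomial (Fin N) F) :
    exch i j (nablaLin β i f) = nablaLin β j (exch i j f) := by
  rw [permute_nablaLin, Equiv.swap_apply_left]

theorem exch_nablaLin_right (β : F) (i j : Fin N) (f : MvPolynomial (Fin N) F) :
    exch i j (nablaLin β j f) = nablaLin β i (exch i j f) := by
  rw [permute_nablaLin, Equiv.swap_apply_right]

theorem exch_nablaLin_of_ne (β : F) {i j k : Fin N} (hi : k ≠ i) (hj : k ≠ j)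
    (f : MvPolynomial (Fin N) F) :
    exch i j (nablaLin β k f) = nablaLin β k (exch i j f) := by
  rw [permute_nablaLin, Equiv.swap_apply_of_ne_of_ne hi hj]

theorem exch_comm (i j : Fin N) (f : MvPolynomial (Fin N) F) : exch i j f = exch j i f := by
  rw [exch, Equiv.swap_comm]

theorem nablaLin_commutator_X_mul (β : F) {i j : Fin N} (h : i ≠ j)
    (f : MvPolynomial (Fin N) F) :
    nablaLin β i (nablaLin β j (X i * f)) - nablaLin β j (nablaLin β i (X i * f))
      = X i * (nablaLin β i (nablaLin β j f) - nablaLin β j (nablaLin β i f)) := by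
  have hs : ∑ l ∈ univ.erase i, exch i l (nablaLin β j f)
      = nablaLin β j (∑ l ∈ univ.erase i, exch i l f)
        + nablaLin β i (exch i j f) - nablaLin β j (exch i j f) := by
    have hj : j ∈ univ.erase i := by simp [h.symm]
    rw [map_sum, ← Finset.add_sum_erase _ _ hj, ← Finset.add_sum_erase _ _ hj,
      exch_nablaLin_right]
    have : ∑ l ∈ (univ.erase i).erase j, exch i l (nablaLin β j f)
        = ∑ l ∈ (univ.erase i).erase j, nablaLin β j (exch i l f) :=
      Finset.sum_congr rfl fun l hl =>
        exch_nablaLin_of_ne β h.symm (Finset.ne_of_mem_erase hl).symm f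
    rw [this]; abel
  rw [nablaLin_X_mul_of_ne β h.symm, nablaLin_X_mul_self, map_sub, map_add, map_add,
    nablaLin_X_mul_self, nablaLin_X_mul_of_ne β h.symm, map_smul, map_smul, hs, exch_comm j i,
    exch_comm j i, exch_nablaLin_left]
  simp only [smul_add, smul_sub, smul_eq_C_mul]
  ring

theorem nablaLin_comm (β : F) (i j : Fin N) (f : MvPolynomial (Fin N) F) :
    nablaLin β i (nablaLin β j f) = nablaLin β j (nablaLin β i f) := by
  rcases eq_or_ne i j with rfl | h
  · rfl
  rw [← sub_eq_zero]
  induction f using MvPolynomial.induction_on with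
  | C a =>
    have key : ∀ k : Fin N, nablaLin β k (C a) = 0 := by
      intro k
      change nabla β k (C a) = 0
      rw [nabla_eq, pderiv_C, Finset.sum_eq_zero, smul_zero, add_zero]
      intro l hl
      exact divDiff_of_Kswap_eq (Finset.ne_of_mem_erase hl).symm (by simp [Kswap])
    simp [key]
  | add p q hp hq =>
    simp only [map_add]
    rw [add_sub_add_comm, hp, hq, add_zero]
  | mul_X p k hp =>
    rw [mul_comm]
    rcases eq_or_ne k i with rfl | hi
    · rw [nablaLin_commutator_X_mul β h, hp, mul_zero]
    rcases eq_or_ne k j with rfl | hj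
    · rw [← neg_sub, nablaLin_commutator_X_mul β h.symm, ← neg_sub, hp, neg_zero, mul_zero,
        neg_zero]
    · rw [nablaLin_X_mul_of_ne β hj.symm, nablaLin_X_mul_of_ne β hi.symm, map_sub, map_sub,
        nablaLin_X_mul_of_ne β hj.symm, nablaLin_X_mul_of_ne β hi.symm, map_smul, map_smul,
        exch_nablaLin_of_ne β h hi.symm, exch_nablaLin_of_ne β h.symm hj.symm]
      linear_combination X k * hp

theorem dunkl_apply (β : F) (i : Fin N) (f : MvPolynomial (Fin N) F) :
    dunkl β i f = X i * nablaLin β i f := rfl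

/-- `[D_i, D_j] = β (D_j - D_i) K_{ij}`. -/
theorem dunkl_commutator (β : F) (i j : Fin N) (f : MvPolynomial (Fin N) F) :
    dunkl β i (dunkl β j f) - dunkl β j (dunkl β i f)
      = β • (dunkl β j (exch i j f) - dunkl β i (exch i j f)) := by
  rcases eq_or_ne i j with rfl | h
  · simp
  simp only [dunkl_apply]
  rw [nablaLin_X_mul_of_ne β h, nablaLin_X_mul_of_ne β h.symm, exch_comm j i, exch_nablaLin_left,
    exch_nablaLin_right, nablaLin_comm β i j]
  simp only [smul_eq_C_mul]
  ring

theorem permute_exch (σ : Equiv.Perm (Fin N)) (i j : Fin N) (f : MvPolynomial (Fin N) F) :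
    permute σ (exch i j f) = exch (σ i) (σ j) (permute σ f) :=
  rename_Kswap σ i j f

theorem exch_exch (i j : Fin N) (f : MvPolynomial (Fin N) F) : exch i j (exch i j f) = f :=
  Kswap_Kswap i j f

theorem exch_dunkl_left (β : F) (i j : Fin N) (f : MvPolynomial (Fin N) F) :
    exch i j (dunkl β i f) = dunkl β j (exch i j f) := by
  rw [permute_dunkl, Equiv.swap_apply_left]

theorem exch_dunkl_right (β : F) (i j : Fin N) (f : MvPolynomial (Fin N) F) :
    exch i j (dunkl β j f) = dunkl β i (exch i j f) := by
  rw [permute_dunkl, Equiv.swap_apply_right]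

theorem exch_dunkl_of_ne (β : F) {i j k : Fin N} (hi : k ≠ i) (hj : k ≠ j)
    (f : MvPolynomial (Fin N) F) :
    exch i j (dunkl β k f) = dunkl β k (exch i j f) := by
  rw [permute_dunkl, Equiv.swap_apply_of_ne_of_ne hi hj]

theorem permute_eq_self {f : MvPolynomial (Fin N) F} (hf : f.IsSymmetric)
    (σ : Equiv.Perm (Fin N)) : permute σ f = f :=
  hf σ

theorem Dlist_cons (β : F) (k : ℕ) (j : Fin N) (l : List (Fin N)) (f : MvPolynomial (Fin N) F) :
    Dlist β k (j :: l) f = dunkl β j (Dlist β (k + 1) l f) + ((k : F) * β) • Dlist β (k + 1) l f :=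
  rfl

theorem permute_Dlist (β : F) (σ : Equiv.Perm (Fin N)) {f : MvPolynomial (Fin N) F}
    (hf : f.IsSymmetric) (l : List (Fin N)) (k : ℕ) :
    permute σ (Dlist β k l f) = Dlist β k (l.map σ) f := by
  induction l generalizing k with
  | nil => exact hf σ
  | cons j l ih => rw [Dlist_cons, List.map_cons, Dlist_cons, map_add, map_smul, permute_dunkl, ih]

theorem exch_Dlist_of_notMem (β : F) {f : MvPolynomial (Fin N) F} (hf : f.IsSymmetric)
    {l : List (Fin N)} (k : ℕ) {a b : Fin N} (ha : a ∉ l) (hb : b ∉ l) :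
    exch a b (Dlist β k l f) = Dlist β k l f := by
  rw [permute_Dlist β _ hf, List.map_congr_left (g := id), List.map_id]
  intro x hx
  exact Equiv.swap_apply_of_ne_of_ne (fun h => ha (h ▸ hx)) (fun h => hb (h ▸ hx))

theorem Dlist_perm (β : F) {f : MvPolynomial (Fin N) F} (hf : f.IsSymmetric)
    {l l' : List (Fin N)} (h : l.Perm l') (hl : l.Nodup) (k : ℕ) :
    Dlist β k l f = Dlist β k l' f := by
  induction h generalizing k with
  | nil => rfl
  | cons j _ ih => rw [Dlist_cons, Dlist_cons, ih (List.nodup_cons.1 hl).2]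
  | swap a b l =>
    simp only [List.nodup_cons, List.mem_cons, not_or] at hl
    have hK := exch_Dlist_of_notMem β hf (k + 1 + 1) hl.1.2 hl.2.1
    have hc := dunkl_commutator β b a (Dlist β (k + 1 + 1) l f)
    rw [hK] at hc
    simp only [Dlist_cons, map_add, map_smul]
    push_cast
    linear_combination (norm := module) hc
  | trans h₁ _ ih₁ ih₂ => rw [ih₁ hl, ih₂ (h₁.nodup_iff.1 hl)]

theorem permute_DJ (β : F) (σ : Equiv.Perm (Fin N)) {f : MvPolynomial (Fin N) F}
    (hf : f.IsSymmetric) (k : ℕ) (J : Finset (Fin N)) :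
    permute σ (DJ β k J f) = DJ β k (J.map σ.toEmbedding) f := by
  rw [DJ, permute_Dlist β σ hf]
  refine Dlist_perm β hf ?_ ((Finset.sort_nodup J _).map σ.injective) k
  rw [List.perm_ext_iff_of_nodup ((Finset.sort_nodup J _).map σ.injective)
    (Finset.sort_nodup _ _)]
  simp only [List.mem_map, Finset.mem_sort, Finset.mem_map, Equiv.coe_toEmbedding, implies_true]

theorem map_swap_eq_self {J : Finset (Fin N)} {a b : Fin N} (h : a ∈ J ↔ b ∈ J) :
    J.map (Equiv.swap a b).toEmbedding = J := by
  ext x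
  simp only [Finset.mem_map_equiv, Equiv.symm_swap]
  rcases eq_or_ne x a with rfl | ha
  · simp [h]
  rcases eq_or_ne x b with rfl | hb
  · simp [h]
  · rw [Equiv.swap_apply_of_ne_of_ne ha hb]

theorem exch_DJ_of_mem_iff (β : F) {f : MvPolynomial (Fin N) F} (hf : f.IsSymmetric) (k : ℕ)
    {J : Finset (Fin N)} {a b : Fin N} (h : a ∈ J ↔ b ∈ J) :
    exch a b (DJ β k J f) = DJ β k J f := by
  rw [permute_DJ β _ hf, map_swap_eq_self h]

theorem DJ_insert (β : F) {f : MvPolynomial (Fin N) F} (hf : f.IsSymmetric)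
    {J : Finset (Fin N)} {k : Fin N} (hk : k ∉ J) :
    DJ β 0 (insert k J) f = dunkl β k (DJ β 1 J f) := by
  have : DJ β 0 (insert k J) f = Dlist β 0 (k :: J.sort (· ≤ ·)) f := by
    refine Dlist_perm β hf ?_ (Finset.sort_nodup _ _) 0
    rw [List.perm_ext_iff_of_nodup (Finset.sort_nodup _ _)
      (List.nodup_cons.2 ⟨by simpa using hk, Finset.sort_nodup _ _⟩)]
    simp
  rw [this, Dlist_cons]
  simp [DJ]

/-- The Cherednik operator `D_k + β ∑_{p j < p k} K_{jk}` attached to an ordering `p` of the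
variables. -/
noncomputable def cherednik (β : F) (p : Fin N → ℕ) (k : Fin N) :
    Module.End F (MvPolynomial (Fin N) F) :=
  dunkl β k + β • ∑ j with p j < p k, exch j k

theorem cherednik_apply (β : F) (p : Fin N → ℕ) (k : Fin N) (h : MvPolynomial (Fin N) F) :
    cherednik β p k h = dunkl β k h + β • ∑ j with p j < p k, exch j k h := by
  simp [cherednik]

theorem cherednik_comm_of_lt (β : F) {p : Fin N → ℕ} {a b : Fin N}
    (hab : p a < p b) (h : MvPolynomial (Fin N) F) :
    cherednik β p a (cherednik β p b h) = cherednik β p b (cherednik β p a h) := by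
  have hne : a ≠ b := fun e => hab.ne (congrArg p e)
  have h1 : ∑ j with p j < p a, exch j a (dunkl β b h)
      = dunkl β b (∑ j with p j < p a, exch j a h) := by
    rw [map_sum]
    refine Finset.sum_congr rfl fun j hj => ?_
    have hj := (Finset.mem_filter.1 hj).2
    exact exch_dunkl_of_ne β (fun e => (hab.trans' hj).ne (congrArg p e).symm) hne.symm h
  have h2 : ∑ j with p j < p b, exch j b (dunkl β a h)
      = dunkl β a (∑ j with p j < p b, exch j b h)
        + (dunkl β b (exch a b h) - dunkl β a (exch a b h)) := by
    have ha : a ∈ ({j | p j < p b} : Finset (Fin N)) := by simpa using hab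
    rw [map_sum, ← Finset.add_sum_erase _ _ ha, ← Finset.add_sum_erase _ _ ha, exch_dunkl_left]
    have : ∑ j ∈ ({j | p j < p b} : Finset (Fin N)).erase a, exch j b (dunkl β a h)
        = ∑ j ∈ ({j | p j < p b} : Finset (Fin N)).erase a, dunkl β a (exch j b h) :=
      Finset.sum_congr rfl fun j hj =>
        exch_dunkl_of_ne β (Finset.ne_of_mem_erase hj).symm hne h
    rw [this]; abel
  have h3 : ∑ j with p j < p a, exch j a (∑ l with p l < p b, exch l b h)
      = ∑ l with p l < p b, exch l b (∑ j with p j < p a, exch j a h) := by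
    simp only [map_sum]
    rw [Finset.sum_comm (s := ({l | p l < p b} : Finset (Fin N)))]
    refine Finset.sum_congr rfl fun j hj => ?_
    have hj := (Finset.mem_filter.1 hj).2
    have hjb : b ≠ j := fun e => (hab.trans' hj).ne (congrArg p e).symm
    have hs : ∀ l, p l < p b → p (Equiv.swap j a l) < p b := by
      intro l hl
      rcases eq_or_ne l j with rfl | h1
      · simpa using hab
      rcases eq_or_ne l a with rfl | h2
      · simpa using hj.trans hab
      · rwa [Equiv.swap_apply_of_ne_of_ne h1 h2]
    refine Finset.sum_bij' (fun l _ => Equiv.swap j a l) (fun l _ => Equiv.swap j a l)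
      ?_ ?_ ?_ ?_ ?_
    · simpa using hs
    · simpa using hs
    · simp
    · simp
    · intro l _
      rw [permute_exch, Equiv.swap_apply_of_ne_of_ne hjb hne.symm]
  have hc := dunkl_commutator β a b h
  simp only [cherednik_apply, map_add, map_smul]
  rw [h1, h2, h3]
  linear_combination (norm := module) hc

theorem cherednik_comm (β : F) {p : Fin N → ℕ} (hp : Function.Injective p) (a b : Fin N) :
    Commute (cherednik β p a) (cherednik β p b) := by
  refine LinearMap.ext fun h => ?_
  change cherednik β p a (cherednik β p b h) = cherednik β p b (cherednik β p a h)
  rcases lt_trichotomy (p a) (p b) with hab | hab | hab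
  · exact cherednik_comm_of_lt β hab h
  · rw [hp hab]
  · exact (cherednik_comm_of_lt β hab h).symm

/-- On symmetric polynomials, `H` is the sum of the squares of the operators `D_k`. -/
theorem Hop_eq_sum_dunkl (β : F) {f : MvPolynomial (Fin N) F} (hf : f.IsSymmetric) :
    Hop β univ f = ∑ k, dunkl β k (dunkl β k f) := by
  have h1 : ∀ k, dunkl β k f = X k * pderiv k f := by
    intro k
    change X k * nabla β k f = _
    rw [nabla_eq, Finset.sum_eq_zero, smul_zero, add_zero]
    intro j hj
    exact divDiff_of_Kswap_eq (Finset.ne_of_mem_erase hj).symm (hf _)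
  have hK : ∀ i j, Kswap i j (X i * pderiv i f) = X j * pderiv j f := by
    intro i j
    rw [← h1, ← h1]
    have := exch_dunkl_left β i j f
    rwa [permute_eq_self hf] at this
  have hA : ∀ i j : Fin N, i ≠ j → Aop i j f
      = X i * divDiff i j (X i * pderiv i f) + X j * divDiff j i (X j * pderiv j f) := by
    intro i j hij
    refine divExact_eq (X_sub_X_ne_zero hij) ?_
    have e1 := mul_divDiff hij (X i * pderiv i f)
    have e2 := mul_divDiff hij.symm (X j * pderiv j f)
    rw [hK] at e1 e2
    linear_combination X i * e1 - X j * e2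
  have h2 : ∀ k, dunkl β k (dunkl β k f) = X k * pderiv k (X k * pderiv k f)
      + β • ∑ j ∈ univ.erase k, X k * divDiff k j (X k * pderiv k f) := by
    intro k
    rw [h1]
    change X k * nabla β k _ = _
    rw [nabla_eq, mul_add, mul_smul_comm, Finset.mul_sum]
  simp only [h2, Finset.sum_add_distrib, Hop, ← Finset.smul_sum]
  congr 2
  have e : ∀ i : Fin N, ∑ j with i < j, Aop i j f
      = ∑ j, ((if i < j then X i * divDiff i j (X i * pderiv i f) else 0)
        + if i < j then X j * divDiff j i (X j * pderiv j f) else 0) := by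
    intro i
    rw [Finset.sum_filter]
    refine Finset.sum_congr rfl fun j _ => ?_
    split_ifs with h
    · exact hA i j h.ne
    · simp
  simp only [e, Finset.sum_add_distrib]
  rw [Finset.sum_comm (f := fun i j => if i < j then X j * divDiff j i (X j * pderiv j f) else 0),
    ← Finset.sum_add_distrib]
  refine Finset.sum_congr rfl fun i _ => ?_
  rw [← Finset.sum_add_distrib, ← Finset.sum_erase_add _ _ (Finset.mem_univ i)]
  simp only [lt_self_iff_false, if_false, add_zero]
  refine Finset.sum_congr rfl fun j hj => ?_
  rcases (Finset.ne_of_mem_erase hj).lt_or_gt with h | h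
  · simp [h, h.le]
  · simp [h, h.le]

theorem sum_sum_lt_add {ι M : Type*} [AddCommGroup M] [Module F M] {p : ι → ℕ}
    (hp : Function.Injective p) (J : Finset ι) (u : ι → M) :
    ∑ k ∈ J, ∑ j ∈ J with p j < p k, (u j + u k) = ((#J : F) - 1) • ∑ k ∈ J, u k := by
  classical
  have h : ∀ k ∈ J, ∑ j ∈ J, ((if p k < p j then u k else 0) + if p j < p k then u k else 0)
      = ((#J : F) - 1) • u k := by
    intro k hk
    rw [← Finset.add_sum_erase _ _ hk, Finset.sum_congr rfl (g := fun _ => u k)]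
    · rw [Finset.sum_const, Finset.card_erase_of_mem hk, ← Nat.cast_smul_eq_nsmul F,
        Nat.cast_pred (Finset.card_pos.2 ⟨k, hk⟩)]
      simp
    · intro j hj
      rcases (hp.ne (Finset.ne_of_mem_erase hj)).lt_or_gt with h | h
      · simp [h, h.le]
      · simp [h, h.le]
  rw [Finset.smul_sum, ← Finset.sum_congr rfl h]
  simp only [Finset.sum_filter, Finset.sum_add_distrib]
  rw [Finset.sum_comm]

/-- Invariance of `g` under the exchange of any two variables indexed by `T`. -/
def ExchInvariant (T : Finset (Fin N)) (g : MvPolynomial (Fin N) F) : Prop :=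
  ∀ a ∈ T, ∀ b ∈ T, exch a b g = g

theorem exch_exch_of_invariant {T : Finset (Fin N)} {g : MvPolynomial (Fin N) F}
    (hg : ExchInvariant T g) {k l j : Fin N} (hl : l ∈ T) (hj : j ∈ T) (hlk : l ≠ k)
    (hlj : l ≠ j) : exch l k (exch j k g) = exch j k g := by
  have h := permute_exch (Equiv.swap j k) l j g
  rw [hg l hl j hj, Equiv.swap_apply_of_ne_of_ne hlj hlk, Equiv.swap_apply_left] at h
  exact h.symm

theorem sum_exch_sum_exch {T : Finset (Fin N)} {g : MvPolynomial (Fin N) F}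
    (hg : ExchInvariant T g) {k : Fin N} (hk : k ∉ T) :
    ∑ l ∈ T, exch l k (∑ j ∈ T, exch j k g)
      = (#T : F) • g + ((#T : F) - 1) • ∑ j ∈ T, exch j k g := by
  have h : ∀ l ∈ T, exch l k (∑ j ∈ T, exch j k g) = g + (∑ j ∈ T, exch j k g - exch l k g) := by
    intro l hl
    have hlk : l ≠ k := fun e => hk (e ▸ hl)
    rw [map_sum, ← Finset.add_sum_erase _ _ hl, exch_exch,
      ← Finset.add_sum_erase _ (fun j => exch j k g) hl,
      add_sub_cancel_left]
    congr 1
    exact Finset.sum_congr rfl fun j hj =>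
      exch_exch_of_invariant hg hl (Finset.mem_of_mem_erase hj) hlk (Finset.ne_of_mem_erase hj).symm
  rw [Finset.sum_congr rfl h, Finset.sum_add_distrib, Finset.sum_sub_distrib, Finset.sum_const,
    Finset.sum_const, ← Nat.cast_smul_eq_nsmul F, ← Nat.cast_smul_eq_nsmul F]
  module

section InitialSegment

variable {p : Fin N → ℕ} {J : Finset (Fin N)} {g : MvPolynomial (Fin N) F}

theorem filter_lt_eq_filter (hlow : ∀ k ∈ J, ∀ j, p j < p k → j ∈ J) {k : Fin N} (hk : k ∈ J) :
    ({j | p j < p k} : Finset (Fin N)) = J.filter (fun j => p j < p k) := by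
  ext j
  simp only [Finset.mem_filter, Finset.mem_univ, true_and]
  exact ⟨fun h => ⟨hlow k hk j h, h⟩, fun h => h.2⟩

theorem cherednik_apply_of_mem (β : F) (hlow : ∀ k ∈ J, ∀ j, p j < p k → j ∈ J)
    (hg : ExchInvariant J g) {k : Fin N} (hk : k ∈ J) :
    cherednik β p k g = dunkl β k g + (β * #{j ∈ J | p j < p k}) • g := by
  rw [cherednik_apply, filter_lt_eq_filter hlow hk, Finset.sum_congr rfl (g := fun _ => g),
    Finset.sum_const, ← Nat.cast_smul_eq_nsmul F, smul_smul]
  intro j hj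
  exact hg j (Finset.mem_filter.1 hj).1 k hk

theorem sum_cherednik_of_mem (β : F) (hlow : ∀ k ∈ J, ∀ j, p j < p k → j ∈ J)
    (hg : ExchInvariant J g) :
    ∑ k ∈ J, cherednik β p k g
      = ∑ k ∈ J, dunkl β k g + (β * ∑ k ∈ J, (#{j ∈ J | p j < p k} : F)) • g := by
  rw [Finset.mul_sum, Finset.sum_smul, ← Finset.sum_add_distrib]
  exact Finset.sum_congr rfl fun k hk => cherednik_apply_of_mem β hlow hg hk

theorem sum_cherednik_sq_of_mem (β : F) (hp : Function.Injective p)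
    (hlow : ∀ k ∈ J, ∀ j, p j < p k → j ∈ J) (hg : ExchInvariant J g) :
    ∑ k ∈ J, cherednik β p k (cherednik β p k g)
      = ∑ k ∈ J, dunkl β k (dunkl β k g) + (β * ((#J : F) - 1)) • ∑ k ∈ J, dunkl β k g
        + (β ^ 2 * ∑ k ∈ J, (#{j ∈ J | p j < p k} : F) ^ 2) • g := by
  have h : ∀ k ∈ J, cherednik β p k (cherednik β p k g) = dunkl β k (dunkl β k g)
      + β • ∑ j ∈ J with p j < p k, (dunkl β j g + dunkl β k g)
      + (β ^ 2 * (#{j ∈ J | p j < p k} : F) ^ 2) • g := by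
    intro k hk
    have h1 : ∑ j with p j < p k, exch j k (dunkl β k g) = ∑ j ∈ J with p j < p k, dunkl β j g := by
      rw [filter_lt_eq_filter hlow hk]
      refine Finset.sum_congr rfl fun j hj => ?_
      rw [exch_dunkl_right, hg j (Finset.mem_filter.1 hj).1 k hk]
    rw [cherednik_apply_of_mem β hlow hg hk, map_add, map_smul,
      cherednik_apply_of_mem β hlow hg hk, cherednik_apply, h1, Finset.sum_add_distrib,
      Finset.sum_const, ← Nat.cast_smul_eq_nsmul F]
    module
  rw [Finset.sum_congr rfl h, Finset.sum_add_distrib, Finset.sum_add_distrib, ← Finset.smul_sum,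
    sum_sum_lt_add (F := F) hp, ← Finset.sum_smul, ← Finset.mul_sum, smul_smul]

theorem filter_lt_eq_union (hlow : ∀ k ∈ J, ∀ j, p j < p k → j ∈ J)
    (hp : Function.Injective p) {k : Fin N} (hk : k ∉ J) :
    ({j | p j < p k} : Finset (Fin N)) = J ∪ {j ∈ Jᶜ | p j < p k} := by
  ext j
  simp only [Finset.mem_filter, Finset.mem_univ, true_and, Finset.mem_union, Finset.mem_compl]
  refine ⟨fun h => ?_, ?_⟩
  · by_cases hj : j ∈ J
    · exact Or.inl hj
    · exact Or.inr ⟨hj, h⟩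
  · rintro (hj | hj)
    · rcases lt_trichotomy (p j) (p k) with h | h | h
      · exact h
      · exact absurd (hp h ▸ hj) hk
      · exact absurd (hlow j hj k h) hk
    · exact hj.2

theorem disjoint_filter_compl {k : Fin N} : Disjoint J {j ∈ Jᶜ | p j < p k} :=
  Finset.disjoint_left.2 fun _ hj h => Finset.mem_compl.1 (Finset.mem_filter.1 h).1 hj

theorem cherednik_apply_of_notMem (β : F) (hp : Function.Injective p)
    (hlow : ∀ k ∈ J, ∀ j, p j < p k → j ∈ J) (hc : ExchInvariant Jᶜ g)
    {k : Fin N} (hk : k ∉ J) (hD : dunkl β k g = 0) :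
    cherednik β p k g = β • ∑ j ∈ J, exch j k g + (β * #{j ∈ Jᶜ | p j < p k}) • g := by
  rw [cherednik_apply, filter_lt_eq_union hlow hp hk, Finset.sum_union disjoint_filter_compl,
    hD, zero_add, Finset.sum_congr (s₁ := {j ∈ Jᶜ | p j < p k}) rfl (g := fun _ => g),
    Finset.sum_const, ← Nat.cast_smul_eq_nsmul F, smul_add, smul_smul]
  intro j hj
  exact hc j (Finset.mem_filter.1 hj).1 k (Finset.mem_compl.2 hk)

theorem sum_cherednik_of_notMem (β : F) (hp : Function.Injective p)
    (hlow : ∀ k ∈ J, ∀ j, p j < p k → j ∈ J) (hc : ExchInvariant Jᶜ g)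
    (hD : ∀ k ∈ Jᶜ, dunkl β k g = 0) :
    ∑ k ∈ Jᶜ, cherednik β p k g = β • ∑ k ∈ Jᶜ, ∑ j ∈ J, exch j k g
      + (β * ∑ k ∈ Jᶜ, (#{j ∈ Jᶜ | p j < p k} : F)) • g := by
  rw [Finset.mul_sum, Finset.sum_smul, Finset.smul_sum, ← Finset.sum_add_distrib]
  exact Finset.sum_congr rfl fun k hk =>
    cherednik_apply_of_notMem β hp hlow hc (Finset.mem_compl.1 hk) (hD k hk)

theorem sum_cherednik_sq_of_notMem (β : F) (hp : Function.Injective p)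
    (hlow : ∀ k ∈ J, ∀ j, p j < p k → j ∈ J) (hg : ExchInvariant J g) (hc : ExchInvariant Jᶜ g)
    (hD : ∀ k ∈ Jᶜ, dunkl β k g = 0) :
    ∑ k ∈ Jᶜ, cherednik β p k (cherednik β p k g)
      = β • ∑ k ∈ Jᶜ, ∑ j ∈ J, exch j k (dunkl β j g)
        + (β ^ 2 * (#J * #Jᶜ)) • g
        + (β ^ 2 * ((#J : F) + #Jᶜ - 2)) • ∑ k ∈ Jᶜ, ∑ j ∈ J, exch j k g
        + (β ^ 2 * ∑ k ∈ Jᶜ, (#{j ∈ Jᶜ | p j < p k} : F) ^ 2) • g := by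
  have h : ∀ k ∈ Jᶜ, cherednik β p k (cherednik β p k g)
      = β • ∑ j ∈ J, exch j k (dunkl β j g) + (β ^ 2 * #J) • g
        + (β ^ 2 * ((#J : F) - 1)) • ∑ j ∈ J, exch j k g
        + β ^ 2 • ∑ l ∈ Jᶜ with p l < p k, (∑ j ∈ J, exch j l g + ∑ j ∈ J, exch j k g)
        + (β ^ 2 * (#{j ∈ Jᶜ | p j < p k} : F) ^ 2) • g := by
    intro k hk
    have hk' := Finset.mem_compl.1 hk
    have h1 : dunkl β k (∑ j ∈ J, exch j k g) = ∑ j ∈ J, exch j k (dunkl β j g) := by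
      rw [map_sum]
      exact Finset.sum_congr rfl fun j _ => (exch_dunkl_left β j k g).symm
    have h2 : ∑ l ∈ Jᶜ with p l < p k, exch l k (∑ j ∈ J, exch j k g)
        = ∑ l ∈ Jᶜ with p l < p k, ∑ j ∈ J, exch j l g := by
      refine Finset.sum_congr rfl fun l hl => ?_
      have hl' := Finset.mem_compl.1 (Finset.mem_filter.1 hl).1
      rw [map_sum]
      refine Finset.sum_congr rfl fun j hj => ?_
      rw [permute_exch, Equiv.swap_apply_right, Equiv.swap_apply_of_ne_of_ne,
        hc l (Finset.mem_compl.2 hl') k hk]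
      · exact fun e => hl' (e ▸ hj)
      · exact fun e => hk' (e ▸ hj)
    have h3 : cherednik β p k (∑ j ∈ J, exch j k g)
        = ∑ j ∈ J, exch j k (dunkl β j g) + β • ((#J : F) • g
          + ((#J : F) - 1) • ∑ j ∈ J, exch j k g
          + ∑ l ∈ Jᶜ with p l < p k, ∑ j ∈ J, exch j l g) := by
      rw [cherednik_apply, filter_lt_eq_union hlow hp hk', Finset.sum_union disjoint_filter_compl,
        h1, h2, sum_exch_sum_exch hg hk']
    have h4 := cherednik_apply_of_notMem β hp hlow hc hk' (hD k hk)
    rw [h4, map_add, map_smul, map_smul, h3, h4, Finset.sum_add_distrib, Finset.sum_const,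
      ← Nat.cast_smul_eq_nsmul F]
    module
  rw [Finset.sum_congr rfl h]
  simp only [Finset.sum_add_distrib (s := Jᶜ), ← Finset.smul_sum, Finset.sum_const,
    ← Finset.sum_smul, ← Finset.mul_sum]
  rw [sum_sum_lt_add hp (F := F), ← Nat.cast_smul_eq_nsmul F]
  module

/-- The operator `D_k + β ∑_{l ∉ J} K_{kl}`. -/
noncomputable def outerCherednik (β : F) (J : Finset (Fin N)) (k : Fin N) :
    Module.End F (MvPolynomial (Fin N) F) :=
  dunkl β k + β • ∑ l ∈ Jᶜ, exch l k

theorem outerCherednik_apply (β : F) (k : Fin N) (h : MvPolynomial (Fin N) F) :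
    outerCherednik β J k h = dunkl β k h + β • ∑ l ∈ Jᶜ, exch l k h := by
  simp [outerCherednik]

theorem sum_outerCherednik (β : F) :
    ∑ k ∈ J, outerCherednik β J k g
      = ∑ k ∈ J, dunkl β k g + β • ∑ k ∈ Jᶜ, ∑ j ∈ J, exch j k g := by
  simp only [outerCherednik_apply, Finset.sum_add_distrib, ← Finset.smul_sum]
  rw [Finset.sum_comm (s := J)]
  simp only [exch_comm]

theorem sum_outerCherednik_sq (β : F) (hc : ExchInvariant Jᶜ g)
    (hD : ∀ k ∈ Jᶜ, dunkl β k g = 0) :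
    ∑ k ∈ J, outerCherednik β J k (outerCherednik β J k g)
      = ∑ k ∈ J, dunkl β k (dunkl β k g) + β • ∑ k ∈ Jᶜ, ∑ j ∈ J, exch j k (dunkl β j g)
        + (β ^ 2 * (#J * #Jᶜ)) • g
        + (β ^ 2 * ((#Jᶜ : F) - 1)) • ∑ k ∈ Jᶜ, ∑ j ∈ J, exch j k g := by
  have h : ∀ k ∈ J, outerCherednik β J k (outerCherednik β J k g)
      = dunkl β k (dunkl β k g) + β • ∑ l ∈ Jᶜ, exch k l (dunkl β k g)
        + (β ^ 2 * #Jᶜ) • g + (β ^ 2 * ((#Jᶜ : F) - 1)) • ∑ l ∈ Jᶜ, exch k l g := by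
    intro k hk
    have h1 : dunkl β k (∑ l ∈ Jᶜ, exch l k g) = 0 := by
      rw [map_sum, Finset.sum_eq_zero]
      intro l hl
      rw [← exch_dunkl_left, hD l hl, map_zero]
    have h2 := sum_exch_sum_exch hc (fun hk' => Finset.mem_compl.1 hk' hk)
    rw [outerCherednik_apply, outerCherednik_apply, map_add, map_smul, h1]
    simp only [map_add, map_smul, Finset.sum_add_distrib, ← Finset.smul_sum]
    rw [h2]
    simp only [exch_comm _ k]
    module
  rw [Finset.sum_congr rfl h]
  simp only [Finset.sum_add_distrib, ← Finset.smul_sum, Finset.sum_const]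
  rw [Finset.sum_comm (s := J), Finset.sum_comm (s := J), ← Nat.cast_smul_eq_nsmul F]
  module

end InitialSegment

theorem Dlist_eq_prod (β : F) {p : Fin N → ℕ} {f : MvPolynomial (Fin N) F} (hf : f.IsSymmetric)
    (l : List (Fin N)) (m : ℕ) (hl : l.Pairwise fun a b => p a < p b)
    (hr : ∀ i (hi : i < l.length), #{j | p j < p l[i]} = m + i) :
    Dlist β (m + 1) l f = (l.map fun j => cherednik β p j + β • 1).prod f := by
  induction l generalizing m with
  | nil => rfl
  | cons j l ih =>
    rw [List.pairwise_cons] at hl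
    have hm : #{x | p x < p j} = m := hr 0 (by simp)
    have ih := ih (m + 1) hl.2 fun i hi => by
      have := hr (i + 1) (by simpa using hi)
      rw [List.getElem_cons_succ] at this
      omega
    have hK : ∀ x ∈ ({x | p x < p j} : Finset (Fin N)),
        exch x j (Dlist β (m + 1 + 1) l f) = Dlist β (m + 1 + 1) l f := by
      intro x hx
      refine exch_Dlist_of_notMem β hf _ (fun h => ?_) fun h => (hl.1 j h).false
      exact (hl.1 x h).asymm (Finset.mem_filter.1 hx).2
    rw [Dlist_cons, List.map_cons, List.prod_cons, Module.End.mul_apply, ← ih,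
      LinearMap.add_apply, cherednik_apply, Finset.sum_congr rfl hK, Finset.sum_const, hm,
      ← Nat.cast_smul_eq_nsmul F, LinearMap.smul_apply, Module.End.one_apply]
    push_cast
    module

/-- The position of a variable in the ordering that starts with the list `l`. -/
def listKey (l : List (Fin N)) (j : Fin N) : ℕ := if j ∈ l then l.idxOf j else l.length + j

theorem listKey_lt_iff {l : List (Fin N)} (j : Fin N) : listKey l j < l.length ↔ j ∈ l := by
  unfold listKey
  split_ifs with h
  · simp [h, List.idxOf_lt_length_iff]
  · simp [h]

theorem listKey_injective (l : List (Fin N)) : Function.Injective (listKey l) := by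
  intro a b h
  have ha := listKey_lt_iff (l := l) a
  have hb := listKey_lt_iff (l := l) b
  rw [h, hb] at ha
  unfold listKey at h
  by_cases hb' : b ∈ l
  · rw [if_pos (ha.1 hb'), if_pos hb'] at h
    exact (List.idxOf_inj (ha.1 hb')).1 h
  · rw [if_neg (fun h' => hb' (ha.2 h')), if_neg hb'] at h
    exact Fin.ext (by omega)

theorem listKey_getElem {l : List (Fin N)} (hl : l.Nodup) (i : ℕ) (hi : i < l.length) :
    listKey l l[i] = i := by
  rw [listKey, if_pos (List.getElem_mem hi), hl.idxOf_getElem]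

theorem card_listKey_lt {l : List (Fin N)} (hl : l.Nodup) (i : ℕ) (hi : i < l.length) :
    #{j | listKey l j < listKey l l[i]} = i := by
  have : ({j | listKey l j < listKey l l[i]} : Finset (Fin N)) = (l.take i).toFinset := by
    ext j
    simp only [Finset.mem_filter, Finset.mem_univ, true_and, List.mem_toFinset,
      listKey_getElem hl i hi, List.mem_take_iff_getElem]
    constructor
    · intro h
      obtain ⟨k, hk, rfl⟩ := List.getElem_of_mem ((listKey_lt_iff j).1 (h.trans hi))
      rw [listKey_getElem hl] at h
      exact ⟨k, by omega, rfl⟩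
    · rintro ⟨k, hk, rfl⟩
      rw [listKey_getElem hl]
      omega
  rw [this, List.toFinset_card_of_nodup (hl.sublist (List.take_sublist i l)), List.length_take]
  omega

/-- `D_{1,J}` acts on symmetric polynomials as a polynomial in commuting Cherednik operators. -/
theorem exists_DJ_eq (β : F) (J : Finset (Fin N)) :
    ∃ p : Fin N → ℕ, Function.Injective p ∧ (∀ k ∈ J, ∀ j, p j < p k → j ∈ J) ∧
      ∃ P : Module.End F (MvPolynomial (Fin N) F), (∀ k, Commute P (cherednik β p k)) ∧
        ∀ f : MvPolynomial (Fin N) F, f.IsSymmetric → DJ β 1 J f = P f := by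
  have hl := Finset.sort_nodup J (· ≤ ·)
  have hinj := listKey_injective (J.sort (· ≤ ·))
  refine ⟨listKey (J.sort (· ≤ ·)), hinj, ?_, _, ?_,
    fun f hf => Dlist_eq_prod (p := listKey (J.sort (· ≤ ·))) β hf _ 0 ?_ ?_⟩
  · intro k hk j h
    rw [← Finset.mem_sort (· ≤ ·), ← listKey_lt_iff] at hk ⊢
    exact h.trans hk
  · intro k
    refine Commute.list_prod_left _ _ fun x hx => ?_
    obtain ⟨j, -, rfl⟩ := List.mem_map.1 hx
    exact (cherednik_comm β hinj j k).add_left ((Commute.one_left _).smul_left β)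
  · rw [List.pairwise_iff_getElem]
    intro a b ha hb hab
    rwa [listKey_getElem hl, listKey_getElem hl]
  · intro i hi
    rw [card_listKey_lt hl, zero_add]

theorem isSymmetric_sum_dunkl (β : F) {f : MvPolynomial (Fin N) F} (hf : f.IsSymmetric) :
    (∑ k, dunkl β k f).IsSymmetric := by
  intro σ
  change permute σ _ = _
  simp only [map_sum, permute_dunkl, permute_eq_self hf]
  exact Equiv.sum_comp σ fun k => dunkl β k f

theorem isSymmetric_sum_dunkl_sq (β : F) {f : MvPolynomial (Fin N) F} (hf : f.IsSymmetric) :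
    (∑ k, dunkl β k (dunkl β k f)).IsSymmetric := by
  intro σ
  change permute σ _ = _
  simp only [map_sum, permute_dunkl, permute_eq_self hf]
  exact Equiv.sum_comp σ fun k => dunkl β k (dunkl β k f)

theorem isSymmetric_smul {f : MvPolynomial (Fin N) F} (hf : f.IsSymmetric) (a : F) :
    (a • f).IsSymmetric := fun σ => by rw [map_smul, hf σ]

theorem sum_outerCherednik_sq_eq (β : F) {f : MvPolynomial (Fin N) F} (hf : f.IsSymmetric)
    (J : Finset (Fin N)) (hD : ∀ k ∈ Jᶜ, dunkl β k (DJ β 1 J f) = 0) :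
    ∑ k ∈ J, outerCherednik β J k (outerCherednik β J k (DJ β 1 J f))
        + (2 - β * #Jᶜ) • ∑ k ∈ J, outerCherednik β J k (DJ β 1 J f)
        + (#J * (1 - β * #Jᶜ)) • DJ β 1 J f
      = DJ β 1 J (∑ k, dunkl β k (dunkl β k f)
        + ((2 : F) • ∑ k, dunkl β k f + ((#J : F) + β * #J * #Jᶜ) • f)) := by
  obtain ⟨p, hp, hlow, P, hPc, hP⟩ := exists_DJ_eq β J
  have hg : ExchInvariant J (DJ β 1 J f) := fun a ha b hb =>
    exch_DJ_of_mem_iff β hf 1 (iff_of_true ha hb)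
  have hc : ExchInvariant Jᶜ (DJ β 1 J f) := fun a ha b hb =>
    exch_DJ_of_mem_iff β hf 1 (iff_of_false (Finset.mem_compl.1 ha) (Finset.mem_compl.1 hb))
  have hfu : ExchInvariant univ f := fun a _ b _ => permute_eq_self hf _
  have hPc' : ∀ k h, P (cherednik β p k h) = cherednik β p k (P h) := fun k h =>
    LinearMap.congr_fun (hPc k) h
  have e1 := sum_cherednik_of_mem β (J := univ) (p := p) (fun _ _ j _ => Finset.mem_univ j) hfu
  have e2 := sum_cherednik_sq_of_mem β (J := univ) hp (fun _ _ j _ => Finset.mem_univ j) hfu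
  replace e1 := congrArg P e1
  replace e2 := congrArg P e2
  simp only [map_sum, map_add, map_smul, hPc', ← hP f hf] at e1 e2
  rw [← Finset.sum_add_sum_compl J, sum_cherednik_of_mem β hlow hg,
    sum_cherednik_of_notMem β hp hlow hc hD] at e1
  rw [← Finset.sum_add_sum_compl J, sum_cherednik_sq_of_mem β hp hlow hg,
    sum_cherednik_sq_of_notMem β hp hlow hg hc hD] at e2
  have hcard : (#(univ : Finset (Fin N)) : F) = #J + #Jᶜ := by
    rw [← Nat.cast_add, Finset.card_add_card_compl, Finset.card_univ]
  have hr1 : ∀ k ∈ J, #{j | p j < p k} = #{j ∈ J | p j < p k} := fun k hk => by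
    rw [filter_lt_eq_filter hlow hk]
  have hr2 : ∀ k ∈ Jᶜ, #{j | p j < p k} = #J + #{j ∈ Jᶜ | p j < p k} := fun k hk => by
    rw [filter_lt_eq_union hlow hp (Finset.mem_compl.1 hk),
      Finset.card_union_of_disjoint disjoint_filter_compl]
  have hR1 : ∑ k, (#{j | p j < p k} : F) = ∑ k ∈ J, (#{j ∈ J | p j < p k} : F)
      + (#J * #Jᶜ + ∑ k ∈ Jᶜ, (#{j ∈ Jᶜ | p j < p k} : F)) := by
    rw [← Finset.sum_add_sum_compl J, Finset.sum_congr rfl fun k hk => congrArg Nat.cast (hr1 k hk),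
      Finset.sum_congr (s₁ := Jᶜ) rfl fun k hk => congrArg Nat.cast (hr2 k hk)]
    simp only [Nat.cast_add, Finset.sum_add_distrib, Finset.sum_const, nsmul_eq_mul]
    ring
  have hρ : 2 * ∑ k ∈ Jᶜ, (#{j ∈ Jᶜ | p j < p k} : F) = ((#Jᶜ : F) - 1) * #Jᶜ := by
    have := sum_sum_lt_add (F := F) hp Jᶜ (fun _ => (1 : F))
    simp only [Finset.sum_const, nsmul_eq_mul, smul_eq_mul, mul_one] at this
    rw [← this, Finset.mul_sum]
    exact Finset.sum_congr rfl fun k _ => by ring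
  have hR2 : ∑ k, (#{j | p j < p k} : F) ^ 2 = ∑ k ∈ J, (#{j ∈ J | p j < p k} : F) ^ 2
      + (#J ^ 2 * #Jᶜ + #J * (((#Jᶜ : F) - 1) * #Jᶜ)
        + ∑ k ∈ Jᶜ, (#{j ∈ Jᶜ | p j < p k} : F) ^ 2) := by
    rw [← Finset.sum_add_sum_compl J,
      Finset.sum_congr rfl fun k hk => congrArg (fun n : ℕ => (n : F) ^ 2) (hr1 k hk),
      Finset.sum_congr (s₁ := Jᶜ) rfl fun k hk => congrArg (fun n : ℕ => (n : F) ^ 2) (hr2 k hk)]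
    simp only [Nat.cast_add, add_sq, Finset.sum_add_distrib, Finset.sum_const, nsmul_eq_mul,
      ← Finset.mul_sum]
    rw [← hρ]
    ring
  rw [hR1] at e1
  rw [hR2, hcard] at e2
  rw [sum_outerCherednik_sq β hc hD, sum_outerCherednik,
    hP _ ((isSymmetric_sum_dunkl_sq β hf).add
      ((isSymmetric_smul (isSymmetric_sum_dunkl β hf) 2).add (isSymmetric_smul hf _)))]
  simp only [map_add, map_smul, map_sum, ← hP f hf]
  linear_combination (norm := module) e2 + (2 - β * ((#J : F) + #Jᶜ - 1)) • e1

theorem permute_mul (σ : Equiv.Perm (Fin N)) (f g : MvPolynomial (Fin N) F) :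
    permute σ (f * g) = permute σ f * permute σ g :=
  map_mul (rename σ) f g

theorem permute_X (σ : Equiv.Perm (Fin N)) (j : Fin N) :
    permute σ (X j : MvPolynomial (Fin N) F) = X (σ j) :=
  rename_X σ j

theorem permute_zJ (σ : Equiv.Perm (Fin N)) (J : Finset (Fin N)) :
    permute σ (zJ J : MvPolynomial (Fin N) F) = zJ (J.map σ.toEmbedding) := by
  change rename σ (zJ J) = _
  simp [zJ, map_prod]

theorem X_mul_zJ_erase {J : Finset (Fin N)} {k : Fin N} (hk : k ∈ J) :
    (X k * zJ (J.erase k) : MvPolynomial (Fin N) F) = zJ J :=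
  Finset.mul_prod_erase J _ hk

theorem exch_zJ_of_mem {J : Finset (Fin N)} {k j : Fin N} (hj : j ∈ J) (hk : k ∉ J) :
    exch k j (zJ J : MvPolynomial (Fin N) F) = X k * zJ (J.erase j) := by
  rw [← X_mul_zJ_erase hj, permute_mul, permute_X, Equiv.swap_apply_right, permute_zJ,
    map_swap_eq_self]
  simp [hk]

theorem divDiff_zJ_of_iff {J : Finset (Fin N)} {k j : Fin N} (hkj : k ≠ j)
    (h : k ∈ J ↔ j ∈ J) : divDiff k j (zJ J : MvPolynomial (Fin N) F) = 0 := by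
  refine divDiff_of_Kswap_eq hkj ?_
  change exch k j (zJ J) = _
  rw [permute_zJ, map_swap_eq_self h]

theorem divDiff_zJ_of_mem_right {J : Finset (Fin N)} {k j : Fin N} (hj : j ∈ J) (hk : k ∉ J) :
    divDiff k j (zJ J : MvPolynomial (Fin N) F) = -zJ (J.erase j) := by
  refine divDiff_eq (by rintro rfl; exact hk hj) ?_
  change _ = _ - exch k j (zJ J)
  rw [exch_zJ_of_mem hj hk, ← X_mul_zJ_erase hj]
  ring

theorem divDiff_zJ_of_mem_left {J : Finset (Fin N)} {k j : Fin N} (hk : k ∈ J) (hj : j ∉ J) :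
    divDiff k j (zJ J : MvPolynomial (Fin N) F) = zJ (J.erase k) := by
  refine divDiff_eq (by rintro rfl; exact hj hk) ?_
  change _ = _ - exch k j (zJ J)
  rw [exch_comm, exch_zJ_of_mem hk hj, ← X_mul_zJ_erase hk]
  ring

theorem pderiv_zJ_of_notMem {J : Finset (Fin N)} {k : Fin N} (hk : k ∉ J) :
    pderiv k (zJ J : MvPolynomial (Fin N) F) = 0 := by
  refine pderiv_eq_zero_of_notMem_vars fun h => hk ?_
  have := vars_prod (s := J) (fun i => (X i : MvPolynomial (Fin N) F)) h
  simpa using this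

theorem dunkl_zJ_mul_of_notMem (β : F) {J : Finset (Fin N)} {k : Fin N} (hk : k ∉ J)
    (h : MvPolynomial (Fin N) F) :
    dunkl β k (zJ J * h) = zJ J * dunkl β k h - β • ∑ j ∈ J, exch k j (zJ J * h) := by
  have hs : ∑ j ∈ univ.erase k, divDiff k j (zJ J) * Kswap k j h
      = ∑ j ∈ J, -zJ (J.erase j) * exch k j h := by
    symm
    refine (Finset.sum_congr rfl fun j hj => ?_).trans (Finset.sum_subset ?_ ?_)
    · rw [← divDiff_zJ_of_mem_right hj hk]; rfl
    · intro j hj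
      exact Finset.mem_erase.2 ⟨by rintro rfl; exact hk hj, Finset.mem_univ _⟩
    · intro j hj hjJ
      rw [divDiff_zJ_of_iff (Finset.ne_of_mem_erase hj).symm (iff_of_false hk hjJ), zero_mul]
  have hs' : ∑ j ∈ J, exch k j (zJ J * h) = -(X k * ∑ j ∈ J, -zJ (J.erase j) * exch k j h) := by
    rw [Finset.mul_sum, ← Finset.sum_neg_distrib]
    refine Finset.sum_congr rfl fun j hj => ?_
    rw [permute_mul, exch_zJ_of_mem hj hk]
    ring
  change X k * nabla β k (zJ J * h) = zJ J * (X k * nabla β k h) - _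
  rw [nabla_mul, hs, hs', pderiv_zJ_of_notMem hk]
  simp only [smul_eq_C_mul]
  ring

theorem dunkl_zJ_mul_of_mem (β : F) {J : Finset (Fin N)} {k : Fin N} (hk : k ∈ J)
    (h : MvPolynomial (Fin N) F) :
    dunkl β k (zJ J * h) = zJ J * (outerCherednik β J k h + h) := by
  have hs : ∑ j ∈ univ.erase k, divDiff k j (zJ J) * Kswap k j h
      = zJ (J.erase k) * ∑ j ∈ Jᶜ, exch j k h := by
    rw [Finset.mul_sum]
    symm
    refine (Finset.sum_congr rfl fun j hj => ?_).trans (Finset.sum_subset ?_ ?_)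
    · rw [← divDiff_zJ_of_mem_left hk (Finset.mem_compl.1 hj), exch_comm]; rfl
    · intro j hj
      exact Finset.mem_erase.2 ⟨by rintro rfl; exact Finset.mem_compl.1 hj hk, Finset.mem_univ _⟩
    · intro j hj hjJ
      rw [divDiff_zJ_of_iff (Finset.ne_of_mem_erase hj).symm (iff_of_true hk (by simpa using hjJ)),
        zero_mul]
  have hd : pderiv k (zJ J : MvPolynomial (Fin N) F) = zJ (J.erase k) := by
    rw [← X_mul_zJ_erase hk, Derivation.leibniz, pderiv_zJ_of_notMem (Finset.notMem_erase k J),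
      pderiv_X_self]
    simp
  rw [outerCherednik_apply]
  change X k * nabla β k (zJ J * h) = zJ J * (X k * nabla β k h + _ + h)
  rw [nabla_mul, hs, hd, ← X_mul_zJ_erase hk]
  simp only [smul_eq_C_mul]
  ring

theorem sum_sum_exch_eq {i : ℕ} (k : Fin N) (w : Finset (Fin N) → MvPolynomial (Fin N) F)
    (hw : ∀ J a b, exch a b (w J) = w (J.map (Equiv.swap a b).toEmbedding)) :
    ∑ J ∈ univ.powersetCard i with k ∉ J, ∑ j ∈ J, exch k j (w J)
      = ∑ J ∈ univ.powersetCard i with k ∈ J, (#Jᶜ : F) • w J := by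
  have : ∀ J : Finset (Fin N), (#Jᶜ : F) • w J = ∑ _l ∈ Jᶜ, w J := fun J => by
    rw [Finset.sum_const, Nat.cast_smul_eq_nsmul]
  simp only [this, hw]
  rw [Finset.sum_sigma', Finset.sum_sigma']
  refine Finset.sum_bij' (fun x _ => ⟨x.1.map (Equiv.swap k x.2).toEmbedding, x.2⟩)
    (fun x _ => ⟨x.1.map (Equiv.swap k x.2).toEmbedding, x.2⟩) ?_ ?_ ?_ ?_ ?_
  · rintro ⟨J, j⟩ h
    simp only [Finset.mem_sigma, Finset.mem_filter, Finset.mem_powersetCard_univ,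
      Finset.card_map, Finset.mem_map_equiv, Finset.mem_compl, Equiv.symm_swap,
      Equiv.swap_apply_left, Equiv.swap_apply_right] at h ⊢
    tauto
  · rintro ⟨J, j⟩ h
    simp only [Finset.mem_sigma, Finset.mem_filter, Finset.mem_powersetCard_univ,
      Finset.card_map, Finset.mem_map_equiv, Finset.mem_compl, Equiv.symm_swap,
      Equiv.swap_apply_left, Equiv.swap_apply_right] at h ⊢
    tauto
  · rintro ⟨J, j⟩ _
    simp only [Finset.map_map, ← Equiv.trans_toEmbedding]
    simp
  · rintro ⟨J, j⟩ _
    simp only [Finset.map_map, ← Equiv.trans_toEmbedding]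
    simp
  · rintro ⟨J, j⟩ _
    rfl

theorem permute_Bplus_summand (β : F) {f : MvPolynomial (Fin N) F} (hf : f.IsSymmetric)
    (σ : Equiv.Perm (Fin N)) (J : Finset (Fin N)) :
    permute σ (zJ J * DJ β 1 J f)
      = zJ (J.map σ.toEmbedding) * DJ β 1 (J.map σ.toEmbedding) f := by
  rw [permute_mul, permute_zJ, permute_DJ β σ hf]

theorem isSymmetric_Bplus (β : F) {f : MvPolynomial (Fin N) F} (hf : f.IsSymmetric) (i : ℕ) :
    (Bplus β i univ f).IsSymmetric := by
  intro σ
  change permute σ _ = _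
  simp only [Bplus, map_sum, permute_Bplus_summand β hf]
  refine Finset.sum_bij' (fun J _ => J.map σ.toEmbedding) (fun J _ => J.map σ.symm.toEmbedding)
    ?_ ?_ ?_ ?_ ?_
  · simp
  · simp
  · intro J _
    simp only [Finset.map_map, ← Equiv.trans_toEmbedding]
    simp
  · intro J _
    simp only [Finset.map_map, ← Equiv.trans_toEmbedding]
    simp
  · intro J _
    rfl

theorem Dlist_add (β : F) (l : List (Fin N)) (k : ℕ) (f g : MvPolynomial (Fin N) F) :
    Dlist β k l (f + g) = Dlist β k l f + Dlist β k l g := by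
  induction l generalizing k with
  | nil => rfl
  | cons j l ih => rw [Dlist_cons, Dlist_cons, Dlist_cons, ih, map_add]; module

theorem Dlist_smul (β : F) (l : List (Fin N)) (k : ℕ) (a : F) (f : MvPolynomial (Fin N) F) :
    Dlist β k l (a • f) = a • Dlist β k l f := by
  induction l generalizing k with
  | nil => rfl
  | cons j l ih => rw [Dlist_cons, Dlist_cons, ih, map_smul]; module

/-- `D_{k,J}` as a linear map. -/
noncomputable def DJLin (β : F) (k : ℕ) (J : Finset (Fin N)) :
    Module.End F (MvPolynomial (Fin N) F) where
  toFun := DJ β k J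
  map_add' := Dlist_add β _ k
  map_smul' := Dlist_smul β _ k

/-- `B⁺_i` as a linear map. -/
noncomputable def BplusLin (β : F) (i : ℕ) : Module.End F (MvPolynomial (Fin N) F) where
  toFun := Bplus β i univ
  map_add' f g := by
    simp only [Bplus, ← Finset.sum_add_distrib, ← mul_add]
    exact Finset.sum_congr rfl fun J _ => congrArg _ (map_add (DJLin β 1 J) f g)
  map_smul' a f := by
    simp only [Bplus, Finset.smul_sum, RingHom.id_apply, ← mul_smul_comm]
    exact Finset.sum_congr rfl fun J _ => congrArg _ (map_smul (DJLin β 1 J) a f)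

theorem sum_dunkl_sq_Bplus (β : F) {i : ℕ} {f : MvPolynomial (Fin N) F} (hf : f.IsSymmetric)
    (h0 : ∀ J ∈ univ.powersetCard (i + 1), DJ β 0 J f = 0) :
    ∑ k, dunkl β k (dunkl β k (Bplus β i univ f))
      = Bplus β i univ (∑ k, dunkl β k (dunkl β k f)
        + ((2 : F) • ∑ k, dunkl β k f + ((i : F) + β * i * ((N - i : ℕ) : F)) • f)) := by
  have hD : ∀ J ∈ univ.powersetCard i, ∀ k ∉ J, dunkl β k (DJ β 1 J f) = 0 := by
    intro J hJ k hk
    rw [← DJ_insert β hf hk]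
    refine h0 _ ?_
    rw [Finset.mem_powersetCard_univ] at hJ ⊢
    rw [Finset.card_insert_of_notMem hk, hJ]
  have h1 : ∀ k, dunkl β k (Bplus β i univ f) = ∑ J ∈ univ.powersetCard i with k ∈ J,
      zJ J * (outerCherednik β J k (DJ β 1 J f) + (1 - β * #Jᶜ) • DJ β 1 J f) := by
    intro k
    have hs : ∑ J ∈ univ.powersetCard i with k ∉ J, dunkl β k (zJ J * DJ β 1 J f)
        = -(β • ∑ J ∈ univ.powersetCard i with k ∈ J, (#Jᶜ : F) • (zJ J * DJ β 1 J f)) := by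
      rw [← sum_sum_exch_eq k (fun J => zJ J * DJ β 1 J f)
        fun J a b => permute_Bplus_summand β hf _ J, Finset.smul_sum, ← Finset.sum_neg_distrib]
      refine Finset.sum_congr rfl fun J hJ => ?_
      rw [Finset.mem_filter] at hJ
      rw [dunkl_zJ_mul_of_notMem β hJ.2, hD J hJ.1 k hJ.2, mul_zero, zero_sub]
    rw [Bplus, map_sum, ← Finset.sum_filter_add_sum_filter_not _ (fun J => k ∈ J), hs,
      Finset.smul_sum, ← sub_eq_add_neg, ← Finset.sum_sub_distrib]
    refine Finset.sum_congr rfl fun J hJ => ?_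
    rw [dunkl_zJ_mul_of_mem β (Finset.mem_filter.1 hJ).2, sub_smul, one_smul]
    simp only [mul_add, mul_sub, mul_smul_comm, mul_smul]
    abel
  have h2 : ∀ k, dunkl β k (dunkl β k (Bplus β i univ f))
      = ∑ J ∈ univ.powersetCard i with k ∈ J,
        zJ J * (outerCherednik β J k (outerCherednik β J k (DJ β 1 J f))
          + (2 - β * #Jᶜ) • outerCherednik β J k (DJ β 1 J f) + (1 - β * #Jᶜ) • DJ β 1 J f) := by
    intro k
    rw [h1, map_sum]
    refine Finset.sum_congr rfl fun J hJ => ?_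
    rw [dunkl_zJ_mul_of_mem β (Finset.mem_filter.1 hJ).2, map_add, map_smul]
    congr 1
    module
  simp only [h2, Finset.sum_filter]
  rw [Finset.sum_comm, Bplus]
  refine Finset.sum_congr rfl fun J hJ => ?_
  have hi := Finset.mem_powersetCard_univ.1 hJ
  have key := sum_outerCherednik_sq_eq β hf J fun k hk => hD J hJ k (Finset.mem_compl.1 hk)
  have hc : #Jᶜ = N - i := by rw [Finset.card_compl, Fintype.card_fin, hi]
  rw [hi, hc] at key
  rw [← key, ← Finset.sum_filter, Finset.filter_mem_eq_inter, Finset.univ_inter, ← Finset.mul_sum,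
    Finset.sum_add_distrib, Finset.sum_add_distrib, ← Finset.smul_sum, Finset.sum_const, hi, hc,
    ← Nat.cast_smul_eq_nsmul F, smul_smul]

theorem LinearMap.exists_comp_eq_of_ker_le_ker {K V W U : Type*} [Field K] [AddCommGroup V]
    [Module K V] [AddCommGroup W] [Module K W] [AddCommGroup U] [Module K U]
    (T : V →ₗ[K] W) (E : V →ₗ[K] U) (h : LinearMap.ker T ≤ LinearMap.ker E) :
    ∃ G : W →ₗ[K] U, ∀ v, G (T v) = E v := by
  obtain ⟨S, hS⟩ := T.rangeRestrict.exists_rightInverse_of_surjective T.range_rangeRestrict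
  obtain ⟨G, hG⟩ := LinearMap.exists_extend (E ∘ₗ S)
  refine ⟨G, fun v => ?_⟩
  have h1 : G (T v) = E (S (T.rangeRestrict v)) := LinearMap.congr_fun hG (T.rangeRestrict v)
  have h2 : T (S (T.rangeRestrict v)) = T v :=
    congrArg Subtype.val (LinearMap.congr_fun hS (T.rangeRestrict v))
  rw [h1, ← sub_eq_zero, ← map_sub]
  exact h (by rw [LinearMap.mem_ker, map_sub, h2, sub_self])

end DunklAlgebra

/-- there are linear operators `G_J` (for `|J| = i+1`) such that on every
symmetric polynomial `f`,
`[H, B⁺_i] f = B⁺_i (2 ∑_j D_j + i + β i(N-i)) f + ∑_J G_J Ñ_{i+1,J} f`. -/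
theorem statement_7 {F : Type*} [Field F] [CharZero F] {N : ℕ} (β : F) (i : ℕ)
    (hi1 : 1 ≤ i) (hiN : i ≤ N - 1) :
    ∃ G : Finset (Fin N) → (MvPolynomial (Fin N) F →ₗ[F] MvPolynomial (Fin N) F),
      ∀ f : MvPolynomial (Fin N) F, f.IsSymmetric →
        Hop β Finset.univ (Bplus β i Finset.univ f)
            - Bplus β i Finset.univ (Hop β Finset.univ f)
        = Bplus β i Finset.univ
            ((2 : F) • (∑ j : Fin N, Dop β j f)
              + ((i : F) + β * (i : F) * ((N - i : ℕ) : F)) • f)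
          + ∑ J ∈ Finset.univ.powersetCard (i + 1), G J (DJ β 0 J f) := by
  let S := Subalgebra.toSubmodule (symmetricSubalgebra (Fin N) F)
  let c : F := (i : F) + β * (i : F) * ((N - i : ℕ) : F)
  let D : Module.End F (MvPolynomial (Fin N) F) := ∑ k, dunkl β k
  let Sq : Module.End F (MvPolynomial (Fin N) F) := ∑ k, dunkl β k * dunkl β k
  let B : Module.End F (MvPolynomial (Fin N) F) := BplusLin β i
  let T : S →ₗ[F] (univ.powersetCard (i + 1) : Finset (Finset (Fin N))) →
      MvPolynomial (Fin N) F := LinearMap.pi fun J => DJLin β 0 J.1 ∘ₗ S.subtype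
  let E : S →ₗ[F] MvPolynomial (Fin N) F :=
    (Sq * B - B * Sq - B * ((2 : F) • D + c • 1)) ∘ₗ S.subtype
  have hSq : ∀ g, Sq g = ∑ k, dunkl β k (dunkl β k g) := fun g => by
    simp [Sq, LinearMap.sum_apply]
  have hD : ∀ g, D g = ∑ k, dunkl β k g := fun g => LinearMap.sum_apply _ _ _
  have hE : ∀ f : S, E f = ∑ k, dunkl β k (dunkl β k (Bplus β i univ f.1))
      - Bplus β i univ (∑ k, dunkl β k (dunkl β k f.1))
      - Bplus β i univ ((2 : F) • (∑ k, dunkl β k f.1) + c • f.1) := fun f => by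
    rw [← hSq, ← hSq, ← hD]
    rfl
  obtain ⟨G, hG⟩ := LinearMap.exists_comp_eq_of_ker_le_ker T E <| by
    intro f hf
    rw [LinearMap.mem_ker] at hf ⊢
    have h0 : ∀ J ∈ univ.powersetCard (i + 1), DJ β 0 J f.1 = 0 := fun J hJ =>
      congrFun hf ⟨J, hJ⟩
    rw [hE, sum_dunkl_sq_Bplus β f.2 h0, sub_sub, sub_eq_zero]
    exact map_add (BplusLin β i) (∑ k, dunkl β k (dunkl β k f.1))
      ((2 : F) • (∑ k, dunkl β k f.1) + c • f.1)
  refine ⟨fun J => if hJ : J ∈ univ.powersetCard (i + 1) then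
    G ∘ₗ LinearMap.single F (fun _ => MvPolynomial (Fin N) F) ⟨J, hJ⟩ else 0, fun f hf => ?_⟩
  have hsum : ∑ J ∈ univ.powersetCard (i + 1),
      (if hJ : J ∈ univ.powersetCard (i + 1) then
        G ∘ₗ LinearMap.single F (fun _ => MvPolynomial (Fin N) F) ⟨J, hJ⟩ else 0) (DJ β 0 J f)
      = E ⟨f, hf⟩ := by
    rw [← hG, ← Finset.univ_sum_single (T ⟨f, hf⟩), map_sum, ← Finset.sum_coe_sort]
    refine Finset.sum_congr rfl fun J _ => ?_
    rw [dif_pos J.2]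
    rfl
  rw [hsum, hE, Hop_eq_sum_dunkl β hf, Hop_eq_sum_dunkl β (isSymmetric_Bplus β hf i)]
  exact (add_sub_cancel _ _).symm
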